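/- Deletion-restriction for length: Let A be a hyperplane arrangement in K^n defined by f, let H_0 ∈ A with defining linear polynomial h_0, let A' = A \ {H_0} be defined by f', and let A'' = {H ∩ H_0 : H ∈ A', H ∩ H_0 ≠ ∅} be the restricted arrangement in the affine space H_0, defined by f'' in the affine ring R'' = R/(h_0). Then length H^1_{(f)}(R) = length H^1_{(f')}(R) + length H^1_{(f'')}(R'') + 1, where lengths are over D_n, D_n, and D_{n-1} respectively. -/

import Mathlib

open Polynomial MvPolynomial

/-- Defining relations of the `n`-th Weyl algebra over `K`:
generators `Sum.inl i` are the multiplication operators `x_i`, generators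
`Sum.inr i` are the partial derivations `∂_i`. -/
inductive WeylRel (K : Type) [Field K] (n : ℕ) :
    FreeAlgebra K (Fin n ⊕ Fin n) → FreeAlgebra K (Fin n ⊕ Fin n) → Prop
  | xx (i j : Fin n) : WeylRel K n
      (FreeAlgebra.ι K (Sum.inl i) * FreeAlgebra.ι K (Sum.inl j))
      (FreeAlgebra.ι K (Sum.inl j) * FreeAlgebra.ι K (Sum.inl i))
  | dd (i j : Fin n) : WeylRel K n
      (FreeAlgebra.ι K (Sum.inr i) * FreeAlgebra.ι K (Sum.inr j))
      (FreeAlgebra.ι K (Sum.inr j) * FreeAlgebra.ι K (Sum.inr i))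
  | dx (i j : Fin n) : WeylRel K n
      (FreeAlgebra.ι K (Sum.inr i) * FreeAlgebra.ι K (Sum.inl j))
      (FreeAlgebra.ι K (Sum.inl j) * FreeAlgebra.ι K (Sum.inr i)
        + if i = j then 1 else 0)

/-- The `n`-th Weyl algebra `D_n` over `K`. -/
abbrev Weyl (K : Type) [Field K] (n : ℕ) : Type := RingQuot (WeylRel K n)

/-- The operator `x_i ∈ D_n`. -/
noncomputable def wX (K : Type) [Field K] (n : ℕ) (i : Fin n) : Weyl K n :=
  RingQuot.mkAlgHom K (WeylRel K n) (FreeAlgebra.ι K (Sum.inl i))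

/-- The operator `∂_i ∈ D_n`. -/
noncomputable def wD (K : Type) [Field K] (n : ℕ) (i : Fin n) : Weyl K n :=
  RingQuot.mkAlgHom K (WeylRel K n) (FreeAlgebra.ι K (Sum.inr i))

/-- The Bernstein filtration on the Weyl algebra: `F_k(D_n)` is spanned by the
monomials `x^α ∂^β` with `|α| + |β| ≤ k`. -/
noncomputable def bernsteinF (K : Type) [Field K] (n : ℕ) (k : ℤ) :
    Submodule K (Weyl K n) :=
  Submodule.span K {w | ∃ α β : Fin n → ℕ,
    ((∑ i, α i : ℕ) + (∑ i, β i : ℕ) : ℤ) ≤ k ∧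
    w = ((List.finRange n).map fun i => wX K n i ^ α i).prod *
        ((List.finRange n).map fun i => wD K n i ^ β i).prod}

/-- A good Bernstein filtration on a left `D_n`-module `M`. -/
structure GoodFiltration (K : Type) [Field K] (n : ℕ) (M : Type)
    [AddCommGroup M] [Module K M] [Module (Weyl K n) M]
    [IsScalarTower K (Weyl K n) M] (F : ℤ → Submodule K M) : Prop where
  mono : ∀ k, F k ≤ F (k + 1)
  exhaustive : ∀ m : M, ∃ k, m ∈ F k
  compat : ∀ j k : ℤ, ∀ w ∈ bernsteinF K n j, ∀ m ∈ F k, w • m ∈ F (j + k)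
  bddBelow : ∃ k₀ : ℤ, ∀ k < k₀, F k = ⊥
  finiteDim : ∀ k, FiniteDimensional K (F k)
  good : ∃ k₁ : ℤ, ∀ k ≥ k₁, ∀ j ≥ (0 : ℤ),
    F (j + k) ≤ Submodule.span K
      {m | ∃ w ∈ bernsteinF K n j, ∃ v ∈ F k, m = w • v}

/-- `HasMult K n M m` : the holonomic module `M` admits a good Bernstein filtration
whose Hilbert polynomial `h` satisfies `(deg h)! · (leading coeff of h) = m`; i.e.
the multiplicity of `M` is `m`. -/
def HasMult (K : Type) [Field K] (n : ℕ) (M : Type)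
    [AddCommGroup M] [Module K M] [Module (Weyl K n) M]
    [IsScalarTower K (Weyl K n) M] (m : ℚ) : Prop :=
  ∃ F : ℤ → Submodule K M, GoodFiltration K n M F ∧
    ∃ h : Polynomial ℚ,
      (∃ N : ℤ, ∀ k ≥ N, (Module.finrank K (F k) : ℚ) = h.eval (k : ℚ)) ∧
      m = (Nat.factorial h.natDegree : ℚ) * h.leadingCoeff

/-- `M` is a holonomic left `D_n`-module. -/
def IsHolonomic (K : Type) [Field K] (n : ℕ) (M : Type)
    [AddCommGroup M] [Module K M] [Module (Weyl K n) M]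
    [IsScalarTower K (Weyl K n) M] : Prop :=
  Subsingleton M ∨
  ∃ F : ℤ → Submodule K M, GoodFiltration K n M F ∧
    ∃ h : Polynomial ℚ,
      (∃ N : ℤ, ∀ k ≥ N, (Module.finrank K (F k) : ℚ) = h.eval (k : ℚ)) ∧
      h.natDegree = n

/-- The length of a module: the Krull dimension of its lattice of submodules. -/
noncomputable def mlength (A : Type) [Ring A] (M : Type) [AddCommGroup M]
    [Module A M] : WithBot ℕ∞ :=
  Order.krullDim (Submodule A M)

section LocalCoh
variable (K : Type) [Field K] (n : ℕ)

/-- The zero set in `K^n` of a polynomial. -/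
def zeroSet (p : MvPolynomial (Fin n) K) : Set (Fin n → K) :=
  {x | MvPolynomial.eval x p = 0}

/-- The property that a given `D_n`-module structure on the localization
`R[f⁻¹]` is the natural one: `x_i` acts by multiplication and `∂_i` acts as the
(unique) derivation of `R[f⁻¹]` extending `∂/∂x_i` on `R`. -/
def NatActs (f : MvPolynomial (Fin n) K)
    [Module (Weyl K n) (Localization.Away f)] : Prop :=
  (∀ (i : Fin n) (m : Localization.Away f),
      wX K n i • m =
        algebraMap (MvPolynomial (Fin n) K) (Localization.Away f)
          (MvPolynomial.X i) * m) ∧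
  (∀ i : Fin n, ∃ δ : Derivation K (Localization.Away f) (Localization.Away f),
      (∀ m, wD K n i • m = δ m) ∧
      ∀ r : MvPolynomial (Fin n) K,
        δ (algebraMap (MvPolynomial (Fin n) K) (Localization.Away f) r) =
          algebraMap (MvPolynomial (Fin n) K) (Localization.Away f)
            (MvPolynomial.pderiv i r))

/-- The first local cohomology module `H¹_{(f)}(R) = R[f⁻¹]/R` as a left
`D_n`-module. -/
noncomputable abbrev H1 (f : MvPolynomial (Fin n) K)
    [Module (Weyl K n) (Localization.Away f)] : Type :=
  (Localization.Away f) ⧸ Submodule.span (Weyl K n)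
    (Set.range (algebraMap (MvPolynomial (Fin n) K) (Localization.Away f)))

end LocalCoh

section Arrangement
open scoped Classical
variable (K : Type) [Field K] (n : ℕ)

/-- The intersection poset of an arrangement `𝒜` of hyperplanes inside the
ambient affine subspace `V0`: all nonempty intersections of subfamilies
(including the ambient space `V0` itself, as the empty intersection). -/
noncomputable def interPoset (V0 : Set (Fin n → K))
    (𝒜 : Finset (Set (Fin n → K))) : Finset (Set (Fin n → K)) :=
  (𝒜.powerset.image fun S => V0 ∩ ⋂ H ∈ S, H).filter fun X => X ≠ ∅

/-- Codimension of `X` inside the ambient affine subspace `V0`. -/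
noncomputable def codim (V0 X : Set (Fin n → K)) : ℕ :=
  Module.finrank K (vectorSpan K V0) - Module.finrank K (vectorSpan K X)

/-- `μ` is the Möbius function of the intersection poset of `𝒜` (with ambient
space `V0`), for the order `X ≤ Y ↔ X ⊇ Y`. -/
def IsMobius (V0 : Set (Fin n → K)) (𝒜 : Finset (Set (Fin n → K)))
    (μ : Set (Fin n → K) → ℤ) : Prop :=
  μ V0 = 1 ∧
  ∀ Y ∈ interPoset K n V0 𝒜, Y ≠ V0 →
    ∑ Z ∈ (interPoset K n V0 𝒜).filter fun Z => Y ⊆ Z, μ Z = 0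

/-- The Poincaré polynomial `π(𝒜,t) = ∑_{X ∈ L(𝒜)} μ(X)(−t)^{codim X}`. -/
noncomputable def poin (V0 : Set (Fin n → K)) (𝒜 : Finset (Set (Fin n → K)))
    (μ : Set (Fin n → K) → ℤ) : Polynomial ℤ :=
  ∑ X ∈ interPoset K n V0 𝒜, Polynomial.C (μ X) * (- Polynomial.X) ^ codim K n V0 X

end Arrangement

theorem weyl_comm_pow {D M : Type*} [Ring D] [AddCommGroup M] [Module D M] {t d : D}
    (comm : ∀ m : M, d • t • m = t • d • m + m) (k : ℕ) (m : M) :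
    d • t ^ (k + 1) • m = t ^ (k + 1) • d • m + (k + 1 : D) • t ^ k • m := by
  induction k with
  | zero => simpa using comm m
  | succ k ih =>
    rw [pow_succ' t (k + 1), mul_smul, comm, ih, smul_add, mul_smul, add_assoc]
    congr 1
    rw [smul_smul t, ← Nat.cast_succ k, ← Nat.cast_comm, mul_smul, smul_smul t, ← pow_succ',
      add_smul _ 1, one_smul]

theorem weyl_comm_pow' {D M : Type*} [Ring D] [AddCommGroup M] [Module D M] {t d : D}
    (comm : ∀ m : M, d • t • m = t • d • m + m) (k : ℕ) {m : M} (hm : t • m = 0) :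
    t • d ^ (k + 1) • m = - ((k + 1 : D) • d ^ k • m) := by
  induction k with
  | zero =>
    have := comm m
    rw [hm, smul_zero] at this
    simpa using (eq_neg_of_add_eq_zero_left this.symm)
  | succ k ih =>
    have h := comm (d ^ (k + 1) • m)
    rw [ih, smul_neg] at h
    rw [pow_succ' d (k + 1), mul_smul, eq_sub_of_add_eq h.symm, smul_smul d,
      ← Nat.cast_succ k, ← Nat.cast_comm, mul_smul, smul_smul d, ← pow_succ',
      add_smul _ 1, one_smul]
    abel

/-- Comparison of lengths along a Kashiwara-type equivalence: `ρ` identifies `Q` with the kernel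
of `t` on the `t`-torsion module `M`, and `d` is a derivative with respect to `t`. -/
theorem length_eq_of_kashiwara {D E M Q : Type*} [Ring D] [Ring E] [AddCommGroup M]
    [AddCommGroup Q] [Module D M] [Module E Q] (hunit : ∀ k : ℕ, IsUnit (k + 1 : D))
    (ρ : Q →+ M) (hinj : Function.Injective ρ) (t d : D)
    (comm : ∀ m : M, d • t • m = t • d • m + m) (htors : ∀ m : M, ∃ k : ℕ, t ^ k • m = 0)
    (hker : ∀ m : M, t • m = 0 ↔ ∃ q, ρ q = m)
    (hback : ∀ v : E, ∃ w : D, ∀ q, ρ (v • q) = w • ρ q)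
    (hgen : ∀ T : AddSubgroup M, (∀ m ∈ T, d • m ∈ T) → (∀ m ∈ T, t • m ∈ T) →
      (∀ g : D, (∀ m : M, g • d • m = d • g • m) → (∃ v : E, ∀ q, g • ρ q = ρ (v • q)) →
        ∀ m ∈ T, g • m ∈ T) → ∀ w : D, ∀ m ∈ T, w • m ∈ T) :
    Module.length D M = Module.length E Q := by
  have cancel : ∀ (k : ℕ) (N : Submodule D M) (m : M), (k + 1 : D) • m ∈ N → m ∈ N := by
    intro k N m h
    obtain ⟨u, hu⟩ := hunit k
    have := N.smul_mem (↑u⁻¹ : D) h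
    rwa [← hu, smul_smul, Units.inv_mul, one_smul] at this
  let F : Submodule D M → Submodule E Q := fun N =>
    { carrier := {q | ρ q ∈ N}
      add_mem' := fun {a b} ha hb => by
        simpa using N.add_mem ha hb
      zero_mem' := by simp
      smul_mem' := fun v q hq => by
        obtain ⟨w, hw⟩ := hback v
        simpa [hw] using N.smul_mem w hq }
  have hF : ∀ N q, q ∈ F N ↔ ρ q ∈ N := fun _ _ => Iff.rfl
  have Fle : ∀ N N', F N ≤ F N' → N ≤ N' := by
    intro N N' h
    have key : ∀ k : ℕ, ∀ m ∈ N, t ^ k • m = 0 → m ∈ N' := by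
      intro k
      induction k with
      | zero => intro m _ h0; simp at h0; simp [h0]
      | succ k ih =>
        intro m hm h0
        rcases k with _ | k
        · obtain ⟨q, rfl⟩ := (hker m).1 (by simpa using h0)
          exact h hm
        · have h1 : t • m ∈ N' := ih _ (N.smul_mem _ hm) (by rw [smul_smul, ← pow_succ, h0])
          have h2 : d • t • m + (k + 1 : D) • m ∈ N' := by
            refine ih _ (N.add_mem (N.smul_mem _ (N.smul_mem _ hm)) (N.smul_mem _ hm)) ?_
            have h3 := weyl_comm_pow comm (k + 1) m
            rw [h0, smul_zero] at h3
            rw [comm, add_assoc]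
            have e1 : m + (k + 1 : D) • m = ((k + 1 : ℕ) + 1 : D) • m := by
              push_cast; simp only [add_smul, one_smul]; abel
            rw [e1, smul_add, smul_smul (t ^ (k + 1)) t, ← pow_succ, smul_smul (t ^ (k + 1)),
              ← Nat.cast_succ (k + 1), ← Nat.cast_comm, mul_smul, Nat.cast_succ (k + 1), ← h3]
          refine cancel k N' m ?_
          simpa using N'.sub_mem h2 (N'.smul_mem d h1)
    intro m hm
    obtain ⟨k, hk⟩ := htors m
    exact key k m hm hk
  have htρ : ∀ q, t • ρ q = 0 := fun q => (hker _).2 ⟨q, rfl⟩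
  let S : Submodule E Q → Set M := fun P => {m | ∃ k : ℕ, ∃ p ∈ P, m = d ^ k • ρ p}
  have hS : ∀ (P : Submodule E Q) (a : D), (∀ m ∈ S P, a • m ∈ AddSubgroup.closure (S P)) →
      ∀ m ∈ AddSubgroup.closure (S P), a • m ∈ AddSubgroup.closure (S P) := by
    intro P a h m hm
    induction hm using AddSubgroup.closure_induction with
    | mem x hx => exact h x hx
    | zero => simp
    | add x y _ _ hx hy => rw [smul_add]; exact add_mem hx hy
    | neg x _ hx => rw [smul_neg]; exact neg_mem hx
  have hnat : ∀ (T : AddSubgroup M) (k : ℕ) (m : M), m ∈ T → (k + 1 : D) • m ∈ T := by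
    intro T k m hm
    rw [← Nat.cast_succ, Nat.cast_smul_eq_nsmul]
    exact T.nsmul_mem hm _
  have hstab : ∀ (P : Submodule E Q) (w : D), ∀ m ∈ AddSubgroup.closure (S P),
      w • m ∈ AddSubgroup.closure (S P) := by
    intro P
    refine hgen _ (hS P d ?_) (hS P t ?_) ?_
    · rintro _ ⟨k, p, hp, rfl⟩
      exact AddSubgroup.subset_closure ⟨k + 1, p, hp, by rw [pow_succ', mul_smul]⟩
    · rintro _ ⟨k, p, hp, rfl⟩
      rcases k with _ | k
      · simp [htρ]
      · rw [weyl_comm_pow' comm k (htρ p)]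
        exact neg_mem (hnat _ _ _ (AddSubgroup.subset_closure ⟨k, p, hp, rfl⟩))
    · rintro g hg ⟨v, hv⟩
      refine hS P g ?_
      rintro _ ⟨k, p, hp, rfl⟩
      refine AddSubgroup.subset_closure ⟨k, v • p, P.smul_mem _ hp, ?_⟩
      induction k with
      | zero => simp [hv]
      | succ k ih => rw [pow_succ', mul_smul, mul_smul, hg, ih]
  let G : Submodule E Q → Submodule D M := fun P =>
    { AddSubgroup.closure (S P) with smul_mem' := fun w m hm => hstab P w m hm }
  have hG : ∀ P m, m ∈ G P ↔ m ∈ AddSubgroup.closure (S P) := fun _ _ => Iff.rfl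
  have indep : ∀ (N : ℕ) (c : ℕ → Q), ∑ k ∈ Finset.range N, d ^ k • ρ (c k) = 0 →
      ∀ k < N, c k = 0 := by
    intro N
    induction N with
    | zero => intro c _ k hk; omega
    | succ N ih =>
      intro c h
      have h1 := congrArg (t • ·) h
      simp only [Finset.sum_range_succ', smul_add, Finset.smul_sum, smul_zero,
        weyl_comm_pow' comm _ (htρ _), pow_zero, one_smul, htρ, add_zero] at h1
      have h2 := ih (fun k => - ((k + 1) • c (k + 1))) (by
        rw [← h1]
        refine Finset.sum_congr rfl fun k _ => ?_
        rw [map_neg, map_nsmul, smul_neg, ← Nat.cast_succ, Nat.cast_smul_eq_nsmul, smul_comm])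
      have h3 : ∀ k < N, c (k + 1) = 0 := by
        intro k hk
        have h4 := neg_eq_zero.1 (h2 k hk)
        have h5 : ρ (c (k + 1)) ∈ (⊥ : Submodule D M) := by
          refine cancel k ⊥ _ ?_
          rw [Submodule.mem_bot, ← Nat.cast_succ, Nat.cast_smul_eq_nsmul, ← map_nsmul, h4, map_zero]
        exact hinj (by rw [(Submodule.mem_bot D).1 h5, map_zero])
      intro k hk
      rcases k with _ | k
      · rw [Finset.sum_range_succ', Finset.sum_eq_zero fun k hk => by
          rw [h3 k (Finset.mem_range.1 hk), map_zero, smul_zero]] at h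
        exact hinj (by simpa using h)
      · exact h3 k (by omega)
  have hrep : ∀ (P : Submodule E Q) (m : M), m ∈ G P → ∃ c : ℕ →₀ Q, (∀ k, c k ∈ P) ∧
      m = c.sum fun k q => d ^ k • ρ q := by
    intro P m hm
    rw [hG] at hm
    induction hm using AddSubgroup.closure_induction with
    | mem x hx =>
      obtain ⟨k, p, hp, rfl⟩ := hx
      refine ⟨Finsupp.single k p, fun j => ?_, by simp⟩
      classical
      rw [Finsupp.single_apply]
      split_ifs
      exacts [hp, P.zero_mem]
    | zero => exact ⟨0, by simp, by simp⟩
    | add x y _ _ hx hy =>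
      obtain ⟨c, hc, rfl⟩ := hx
      obtain ⟨c', hc', rfl⟩ := hy
      refine ⟨c + c', fun k => P.add_mem (hc k) (hc' k), ?_⟩
      rw [Finsupp.sum_add_index' (by simp) (by simp)]
    | neg x _ hx =>
      obtain ⟨c, hc, rfl⟩ := hx
      refine ⟨-c, fun k => P.neg_mem (hc k), ?_⟩
      rw [Finsupp.sum_neg_index (by simp)]
      simp [Finsupp.sum]
  have FG : ∀ P, F (G P) = P := by
    intro P
    refine le_antisymm (fun q hq => ?_) fun q hq =>
      AddSubgroup.subset_closure ⟨0, q, hq, by simp⟩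
    obtain ⟨c, hc, h⟩ := hrep P _ ((hF _ _).1 hq)
    obtain ⟨N, hN⟩ := c.support.bddAbove
    have hsub : c.support ⊆ Finset.range (N + 1) := fun k hk =>
      Finset.mem_range.2 (Nat.lt_succ_of_le (hN hk))
    rw [Finsupp.sum_of_support_subset _ hsub _ (by simp)] at h
    have h0 := indep (N + 1) (fun k => if k = 0 then c 0 - q else c k) (by
      rw [Finset.sum_range_succ'] at h ⊢
      simp only [Nat.add_eq_zero_iff, one_ne_zero, and_false, if_false, if_true, pow_zero,
        one_smul, map_sub] at h ⊢
      rw [h]; abel) 0 (by omega)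
    rw [if_pos rfl, sub_eq_zero] at h0
    exact h0 ▸ hc 0
  apply WithBot.coe_injective
  rw [Module.coe_length, Module.coe_length]
  apply le_antisymm
  · refine Order.krullDim_le_of_strictMono F (Monotone.strictMono_of_injective
      (fun N N' h q hq => h hq) fun N N' h => le_antisymm (Fle _ _ h.le) (Fle _ _ h.ge))
  · refine Order.krullDim_le_of_strictMono G (Monotone.strictMono_of_injective
      (fun P P' h => ?_) fun P P' h => by rw [← FG P, h, FG])
    refine fun m hm => AddSubgroup.closure_mono ?_ hm
    rintro _ ⟨k, p, hp, rfl⟩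
    exact ⟨k, p, h hp, rfl⟩

theorem MvPolynomial.exists_eq_of_totalDegree_le_one {σ R : Type*} [Fintype σ] [CommRing R]
    {p : MvPolynomial σ R} (hp : p.totalDegree ≤ 1) :
    ∃ (c : R) (a : σ → R), p = C c + ∑ i, C (a i) * X i := by
  classical
  refine ⟨coeff 0 p, fun i => coeff (Finsupp.single i 1) p, ?_⟩
  ext d
  simp only [coeff_add, coeff_sum, coeff_C_mul, coeff_C, coeff_X]
  by_cases hd : d = 0
  · subst hd
    simp
  · rw [if_neg (Ne.symm hd), zero_add]
    by_cases h : ∃ i, Finsupp.single i 1 = d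
    · obtain ⟨i, rfl⟩ := h
      simp [Finsupp.single_left_inj]
    · push Not at h
      rw [Finset.sum_eq_zero fun i _ => by simp [h i]]
      by_contra hc
      have h1 := (le_totalDegree (mem_support_iff.2 hc)).trans hp
      obtain ⟨i, hi⟩ := Finsupp.ne_iff.1 hd
      have h2 : Finsupp.single i 1 ≤ d := by
        rw [Finsupp.single_le_iff]
        exact Nat.one_le_iff_ne_zero.2 hi
      obtain ⟨d', rfl⟩ := exists_add_of_le h2
      rw [Finsupp.sum_add_index' (by simp) (by simp), Finsupp.sum_single_index rfl] at h1
      refine h i ?_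
      have : d' = 0 := by
        ext j
        by_contra hj
        have : d' j ≤ d'.sum fun _ e => e :=
          Finset.single_le_sum (f := fun j => d' j) (by simp) (Finsupp.mem_support_iff.2 hj)
        simp at hj
        omega
      simp [this]

theorem MvPolynomial.exists_pderiv_eq_C {n : ℕ} {K : Type} [Field K]
    {h : MvPolynomial (Fin n) K} (hh : h.totalDegree = 1) :
    ∃ a : Fin n → K, (∀ i, pderiv i h = C (a i)) ∧ ∃ i, a i ≠ 0 := by
  obtain ⟨c, a, rfl⟩ := exists_eq_of_totalDegree_le_one hh.le
  refine ⟨a, fun i => ?_, ?_⟩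
  · simp [pderiv_X, Pi.single_apply]
  · by_contra! h0
    simp [h0] at hh

/-- Projection of the polynomial ring onto polynomials restricted to a hyperplane. -/
theorem MvPolynomial.exists_hyperplane_projection {n : ℕ} {K : Type} [Field K]
    {h : MvPolynomial (Fin n) K} (hh : h.totalDegree = 1) :
    ∃ s : MvPolynomial (Fin n) K →ₐ[K] MvPolynomial (Fin n) K,
      (∀ r, r - s r ∈ Ideal.span {h}) ∧ (∀ r, r.totalDegree ≤ 1 → (s r).totalDegree ≤ 1) ∧
      ∀ x, ∃ x', eval x' h = 0 ∧ ∀ r, eval x (s r) = eval x' r := by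
  obtain ⟨c, a, rfl⟩ := exists_eq_of_totalDegree_le_one hh.le
  obtain ⟨i, hi⟩ : ∃ i, a i ≠ 0 := by
    by_contra! h0
    simp [h0] at hh
  set h := C c + ∑ i, C (a i) * X i with hdef
  let b : Fin n → K := fun j => if j = i then (a i)⁻¹ else 0
  refine ⟨aeval fun j => X j - C (b j) * h, fun r => ?_, fun r hr => ?_, fun x => ?_⟩
  · induction r using MvPolynomial.induction_on with
    | C k => simp [algebraMap_eq]
    | add p q hp hq =>
      rw [map_add, add_sub_add_comm]
      exact add_mem hp hq
    | mul_X p j hp =>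
      rw [map_mul, aeval_X, mul_sub, ← sub_add, ← sub_mul]
      refine add_mem (Ideal.mul_mem_right _ _ hp) (Ideal.mul_mem_left _ _ (Ideal.mul_mem_left _ _
        (Ideal.mem_span_singleton_self h)))
  · obtain ⟨c', a', rfl⟩ := exists_eq_of_totalDegree_le_one hr
    have hC : ∀ (k : K) (q : MvPolynomial (Fin n) K), q.totalDegree ≤ 1 →
        (C k * q).totalDegree ≤ 1 := fun k q hq =>
      (totalDegree_mul _ _).trans (by simpa using hq)
    simp only [map_add, map_sum, map_mul, aeval_X, aeval_C, algebraMap_eq]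
    refine (totalDegree_add _ _).trans (max_le (by simp) (totalDegree_finsetSum_le fun j _ => ?_))
    refine hC _ _ ((totalDegree_sub _ _).trans (max_le ?_ (hC _ _ hh.le)))
    simp
  · refine ⟨fun j => x j - b j * eval x h, ?_, fun r => ?_⟩
    · have h2 : ∑ j, a j * (b j * eval x h) = eval x h := by
        rw [Finset.sum_eq_single i (by intro j _ hj; simp [b, hj]) (by simp)]
        simp [b, hi]
      have h3 (y : Fin n → K) : eval y h = c + ∑ j, a j * y j := by simp [hdef]
      rw [h3]
      simp only [mul_sub, Finset.sum_sub_distrib]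
      rw [h2, h3]
      ring
    · induction r using MvPolynomial.induction_on with
      | C k => simp
      | add p q hp hq => rw [map_add, map_add, map_add, hp, hq]
      | mul_X p j hp => simp only [map_mul, hp, aeval_X, map_sub, eval_X, eval_C]

theorem MvPolynomial.dvd_of_forall_eval_eq_zero {n : ℕ} {K : Type} [Field K] [CharZero K]
    {b p : MvPolynomial (Fin n) K} (hb : b.totalDegree = 1)
    (h : ∀ x, eval x b = 0 → eval x p = 0) : b ∣ p := by
  obtain ⟨s, h1, -, h3⟩ := exists_hyperplane_projection hb
  have : s p = 0 := by
    refine MvPolynomial.funext fun x => ?_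
    obtain ⟨x', hx', hr⟩ := h3 x
    rw [hr, h _ hx', map_zero]
  have := h1 p
  rwa [‹s p = 0›, sub_zero, Ideal.mem_span_singleton] at this

/-- A Nullstellensatz for the intersection of two hyperplanes. -/
theorem MvPolynomial.exists_dvd_sub_mul_of_forall_eval_eq_zero {n : ℕ} {K : Type} [Field K]
    [CharZero K] {h q p : MvPolynomial (Fin n) K} (hh : h.totalDegree = 1)
    (hq : q.totalDegree = 1) (hp : ∀ x, eval x h = 0 → eval x q = 0 → eval x p = 0) :
    ∃ g, h ∣ p - q * g := by
  obtain ⟨s, h1, h2, h3⟩ := exists_hyperplane_projection hh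
  simp only [Ideal.mem_span_singleton] at h1
  have hsp : ∃ g, s p = s q * g := by
    by_cases hd : (s q).totalDegree = 1
    · refine dvd_of_forall_eval_eq_zero hd fun x hx => ?_
      obtain ⟨x', hx', hr⟩ := h3 x
      rw [hr] at hx ⊢
      exact hp _ hx' hx
    · have h0 : (s q).totalDegree = 0 := by have := h2 q hq.le; omega
      obtain ⟨c, hc⟩ : ∃ c, s q = C c := ⟨_, totalDegree_eq_zero_iff_eq_C.1 h0⟩
      rw [hc]
      by_cases hc0 : c = 0
      · refine ⟨0, MvPolynomial.funext fun x => ?_⟩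
        obtain ⟨x', hx', hr⟩ := h3 x
        rw [hr, hp _ hx' (by rw [← hr, hc]; simp [hc0])]
        simp
      · refine ⟨C c⁻¹ * s p, ?_⟩
        rw [← mul_assoc, ← C_mul, mul_inv_cancel₀ hc0, C_1, one_mul]
  obtain ⟨g, hg⟩ := hsp
  refine ⟨g, ?_⟩
  have : p - q * g = (p - s p) - (q - s q) * g := by rw [hg]; ring
  rw [this]
  exact dvd_sub (h1 p) (Dvd.dvd.mul_right (h1 q) g)

theorem MvPolynomial.exists_pderiv_ne_zero {n : ℕ} {K : Type} [Field K] [CharZero K]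
    {r : MvPolynomial (Fin n) K} (hr : r.totalDegree ≠ 0) :
    ∃ i, pderiv i r ≠ 0 ∧ (pderiv i r).totalDegree < r.totalDegree := by
  classical
  have h0 : ∃ d ∈ r.support, d ≠ 0 := by
    by_contra! h
    refine hr (Nat.le_zero.1 (Finset.sup_le fun d hd => ?_))
    simp [h d hd]
  obtain ⟨d, hd, hd0⟩ := h0
  obtain ⟨i, hi⟩ := Finsupp.ne_iff.1 hd0
  have hle : Finsupp.single i 1 ≤ d := by
    rw [Finsupp.single_le_iff]
    exact Nat.one_le_iff_ne_zero.2 hi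
  refine ⟨i, fun h => ?_, ?_⟩
  · have h1 := coeff_pderiv (i := i) r (d - Finsupp.single i 1)
    rw [h, coeff_zero, tsub_add_cancel_of_le hle] at h1
    have h2 : (((d - Finsupp.single i 1 : Fin n →₀ ℕ) i : K) + 1) ≠ 0 := Nat.cast_add_one_ne_zero _
    rcases mul_eq_zero.1 h1.symm with h | h
    · exact mem_support_iff.1 hd h
    · exact h2 h
  · refine (Finset.sup_lt_iff (Nat.pos_of_ne_zero hr)).2 fun m hm => ?_
    rw [mem_support_iff, coeff_pderiv] at hm
    have := le_totalDegree (mem_support_iff.2 (left_ne_zero_of_mul hm))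
    rw [Finsupp.sum_add_index' (by simp) (by simp), Finsupp.sum_single_index rfl] at this
    omega

theorem Weyl.induction {K : Type} [Field K] {n : ℕ} {P : Weyl K n → Prop}
    (hC : ∀ c, P (algebraMap K _ c)) (hX : ∀ i, P (wX K n i)) (hD : ∀ i, P (wD K n i))
    (hadd : ∀ a b, P a → P b → P (a + b)) (hmul : ∀ a b, P a → P b → P (a * b))
    (w : Weyl K n) : P w := by
  obtain ⟨x, rfl⟩ := RingQuot.mkAlgHom_surjective K (WeylRel K n) w
  induction x using FreeAlgebra.induction with
  | grade0 c => rw [AlgHom.commutes]; exact hC c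
  | grade1 i => rcases i with i | i; exacts [hX i, hD i]
  | mul a b ha hb => rw [map_mul]; exact hmul _ _ ha hb
  | add a b ha hb => rw [map_add]; exact hadd _ _ ha hb

theorem Weyl.smul_mem_of_stable {K : Type} [Field K] {n : ℕ} {M : Type*} [AddCommGroup M]
    [Module (Weyl K n) M] (T : AddSubgroup M)
    (hC : ∀ c : K, ∀ m ∈ T, algebraMap K (Weyl K n) c • m ∈ T)
    (hX : ∀ i, ∀ m ∈ T, wX K n i • m ∈ T) (hD : ∀ i, ∀ m ∈ T, wD K n i • m ∈ T)
    (w : Weyl K n) : ∀ m ∈ T, w • m ∈ T := by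
  induction w using Weyl.induction with
  | hC c => exact hC c
  | hX i => exact hX i
  | hD i => exact hD i
  | hadd a b ha hb => intro m hm; rw [add_smul]; exact add_mem (ha m hm) (hb m hm)
  | hmul a b ha hb => intro m hm; rw [mul_smul]; exact ha _ (hb m hm)

theorem Derivation.comm_away_of_comm {K R T : Type*} [CommRing K] [CommRing R] [Algebra K R]
    [CommRing T] [Algebra K T] {f : R} (π : Localization.Away f →+* T)
    (δ : Derivation K (Localization.Away f) (Localization.Away f)) (δ' : Derivation K T T)
    (h : ∀ r : R, π (δ (algebraMap R _ r)) = δ' (π (algebraMap R _ r)))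
    (s : Localization.Away f) : π (δ s) = δ' (π s) := by
  obtain ⟨n, r, hr⟩ := IsLocalization.Away.surj f s
  have hu : IsUnit (π (algebraMap R (Localization.Away f) (f ^ n))) := by
    rw [map_pow]
    exact (IsLocalization.Away.algebraMap_pow_isUnit f n).map π
  rw [← map_pow] at hr
  have h1 := h r
  rw [← hr, Derivation.leibniz, map_mul, Derivation.leibniz, map_add, smul_eq_mul, smul_eq_mul,
    smul_eq_mul, smul_eq_mul, map_mul, map_mul, h (f ^ n)] at h1
  exact hu.mul_left_cancel (add_left_cancel h1)

theorem Derivation.finset_sum_apply {K A M ι : Type*} [CommSemiring K] [CommSemiring A]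
    [Algebra K A] [AddCommMonoid M] [Module A M] [Module K M] (s : Finset ι)
    (δ : ι → Derivation K A M) (a : A) : (∑ i ∈ s, δ i) a = ∑ i ∈ s, δ i a := by
  classical
  induction s using Finset.induction_on with
  | empty => simp
  | insert i s hi ih => rw [Finset.sum_insert hi, Finset.sum_insert hi, Derivation.add_apply, ih]

theorem Derivation.ext_away {K R : Type*} [CommRing K] [CommRing R] [Algebra K R] {f : R}
    {δ δ' : Derivation K (Localization.Away f) (Localization.Away f)}
    (h : ∀ r : R, δ (algebraMap R _ r) = δ' (algebraMap R _ r)) (s : Localization.Away f) :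
    δ s = δ' s :=
  comm_away_of_comm (RingHom.id _) δ δ' h s

section Action
variable {K : Type} [Field K] {n : ℕ}

theorem Weyl.algebraMap_smul_eq_mul {f : MvPolynomial (Fin n) K}
    [Module (Weyl K n) (Localization.Away f)] [IsScalarTower K (Weyl K n) (Localization.Away f)]
    (c : K) (m : Localization.Away f) : algebraMap K (Weyl K n) c • m =
      algebraMap (MvPolynomial (Fin n) K) (Localization.Away f) (C c) * m := by
  rw [algebraMap_smul, Algebra.smul_def, IsScalarTower.algebraMap_apply K (MvPolynomial (Fin n) K)]
  rfl

theorem Weyl.exists_smul_eq_mul (r : MvPolynomial (Fin n) K) :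
    ∃ w : Weyl K n, ∀ (f : MvPolynomial (Fin n) K) [Module (Weyl K n) (Localization.Away f)]
      [IsScalarTower K (Weyl K n) (Localization.Away f)], NatActs K n f →
      ∀ m : Localization.Away f, w • m = algebraMap (MvPolynomial (Fin n) K) _ r * m := by
  induction r using MvPolynomial.induction_on with
  | C c => exact ⟨algebraMap K _ c, fun f _ _ _ m => algebraMap_smul_eq_mul c m⟩
  | add p q hp hq =>
    obtain ⟨w, hw⟩ := hp
    obtain ⟨v, hv⟩ := hq
    exact ⟨w + v, fun f _ _ hf m => by rw [add_smul, hw f hf, hv f hf, map_add, add_mul]⟩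
  | mul_X p i hp =>
    obtain ⟨w, hw⟩ := hp
    exact ⟨w * wX K n i, fun f _ _ hf m => by
      rw [mul_smul, hw f hf, hf.1, map_mul, mul_assoc]⟩

theorem MvPolynomial.derivation_eq_sum (E : Derivation K (MvPolynomial (Fin n) K)
    (MvPolynomial (Fin n) K)) (r : MvPolynomial (Fin n) K) :
    E r = ∑ i, E (X i) * pderiv i r := by
  have : E = ∑ i, E (X i) • pderiv (R := K) i := by
    refine derivation_ext fun i => ?_
    simp [Derivation.finset_sum_apply, pderiv_X, Pi.single_apply]
  conv_lhs => rw [this]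
  simp [Derivation.finset_sum_apply]

theorem Weyl.exists_smul_eq_derivation (E : Derivation K (MvPolynomial (Fin n) K)
      (MvPolynomial (Fin n) K)) :
    ∃ w : Weyl K n, ∀ (f : MvPolynomial (Fin n) K) [Module (Weyl K n) (Localization.Away f)]
      [IsScalarTower K (Weyl K n) (Localization.Away f)], NatActs K n f →
      ∃ δ : Derivation K (Localization.Away f) (Localization.Away f), (∀ m, w • m = δ m) ∧
      ∀ r : MvPolynomial (Fin n) K, δ (algebraMap _ _ r) = algebraMap _ _ (E r) := by
  choose w hw using fun i => exists_smul_eq_mul (E (X i))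
  refine ⟨∑ i, w i * wD K n i, fun f _ _ hf => ?_⟩
  choose δ hδ hδ' using hf.2
  refine ⟨∑ i, algebraMap (MvPolynomial (Fin n) K) (Localization.Away f) (E (X i)) • δ i,
    fun m => ?_, fun r => ?_⟩
  · simp [Finset.sum_smul, mul_smul, hw _ f hf, hδ, Derivation.finset_sum_apply, Algebra.smul_def]
  · rw [derivation_eq_sum E r]
    simp [Derivation.finset_sum_apply, hδ', Algebra.smul_def]

variable {f : MvPolynomial (Fin n) K} [Module (Weyl K n) (Localization.Away f)]
  [IsScalarTower K (Weyl K n) (Localization.Away f)]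

theorem mem_span_range_algebraMap_iff (hf : NatActs K n f) (m : Localization.Away f) :
    m ∈ Submodule.span (Weyl K n)
      (Set.range (algebraMap (MvPolynomial (Fin n) K) (Localization.Away f))) ↔
    ∃ r, algebraMap (MvPolynomial (Fin n) K) (Localization.Away f) r = m := by
  refine ⟨fun h => ?_, fun h => Submodule.subset_span h⟩
  let T : AddSubgroup (Localization.Away f) :=
    (algebraMap (MvPolynomial (Fin n) K) (Localization.Away f)).range.toAddSubgroup
  have hT : ∀ x, x ∈ T ↔ ∃ r, algebraMap (MvPolynomial (Fin n) K) _ r = x := fun _ => Iff.rfl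
  let N : Submodule (Weyl K n) (Localization.Away f) :=
    { T with
      smul_mem' := fun w m hm => by
        refine Weyl.smul_mem_of_stable T ?_ ?_ ?_ w m hm
        · rintro c _ ⟨r, rfl⟩
          exact ⟨MvPolynomial.C c * r, by rw [Weyl.algebraMap_smul_eq_mul, map_mul]⟩
        · rintro i _ ⟨r, rfl⟩
          exact ⟨X i * r, by rw [hf.1, map_mul]⟩
        · rintro i _ ⟨r, rfl⟩
          obtain ⟨δ, h1, h2⟩ := hf.2 i
          exact ⟨pderiv i r, by rw [h1, h2]⟩ }
  exact Submodule.span_le (p := N).2 (fun x hx => hx) h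

theorem isSimpleModule_span_range_algebraMap [CharZero K] (hf : NatActs K n f) (hf0 : f ≠ 0) :
    IsSimpleModule (Weyl K n) (Submodule.span (Weyl K n)
      (Set.range (algebraMap (MvPolynomial (Fin n) K) (Localization.Away f)))) := by
  have hinj : Function.Injective (algebraMap (MvPolynomial (Fin n) K) (Localization.Away f)) :=
    IsLocalization.injective _ (powers_le_nonZeroDivisors_of_noZeroDivisors hf0)
  rw [isSimpleModule_iff_isAtom]
  refine ⟨fun h => ?_, fun N hN => ?_⟩
  · have h1 := (mem_span_range_algebraMap_iff hf _).2 ⟨1, rfl⟩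
    rw [h, Submodule.mem_bot] at h1
    exact one_ne_zero ((map_eq_zero_iff _ hinj).1 h1)
  · by_contra h0
    obtain ⟨m, hm, hm0⟩ := N.ne_bot_iff.1 h0
    obtain ⟨r, rfl⟩ := (mem_span_range_algebraMap_iff hf m).1 (hN.le hm)
    have hr0 : r ≠ 0 := by rintro rfl; simp at hm0
    have key : ∀ (k : ℕ) (r : MvPolynomial (Fin n) K), r.totalDegree < k → r ≠ 0 →
        algebraMap _ (Localization.Away f) r ∈ N → (1 : Localization.Away f) ∈ N := by
      intro k
      induction k with
      | zero => intro r hr; omega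
      | succ k ih =>
        intro r hr hr0 hrN
        by_cases hd : r.totalDegree = 0
        · rw [totalDegree_eq_zero_iff_eq_C] at hd
          set c := coeff 0 r
          have hc : c ≠ 0 := by rintro h; rw [h, map_zero] at hd; exact hr0 hd
          have := N.smul_mem (algebraMap K (Weyl K n) c⁻¹) hrN
          rwa [Weyl.algebraMap_smul_eq_mul, ← map_mul, hd, ← MvPolynomial.C_mul, inv_mul_cancel₀ hc,
            MvPolynomial.C_1,
            map_one] at this
        · obtain ⟨i, hi, hlt⟩ := exists_pderiv_ne_zero hd
          refine ih _ (by omega) hi ?_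
          obtain ⟨δ, h1, h2⟩ := hf.2 i
          rw [← h2, ← h1]
          exact N.smul_mem _ hrN
    refine hN.not_ge ?_
    have h1 := key _ r (Nat.lt_succ_self _) hr0 hm
    intro m hm
    obtain ⟨p, rfl⟩ := (mem_span_range_algebraMap_iff hf m).1 hm
    obtain ⟨w, hw⟩ := Weyl.exists_smul_eq_mul p
    have := N.smul_mem w h1
    rwa [hw f hf, mul_one] at this

theorem length_localization_eq_add_one [CharZero K] (hf : NatActs K n f) (hf0 : f ≠ 0) :
    Module.length (Weyl K n) (Localization.Away f) = Module.length (Weyl K n) (H1 K n f) + 1 := by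
  have := isSimpleModule_span_range_algebraMap hf hf0
  rw [Module.length_eq_add_of_exact _ _ (Submodule.injective_subtype _)
    (Submodule.mkQ_surjective _) (LinearMap.exact_subtype_mkQ (Submodule.span (Weyl K n)
      (Set.range (algebraMap (MvPolynomial (Fin n) K) (Localization.Away f))))),
    Module.length_eq_one, add_comm]

end Action

section Descent
variable {K : Type} [Field K] {m n : ℕ}

theorem MvPolynomial.exists_derivation_lift
    {τ : MvPolynomial (Fin m) K →ₐ[K] MvPolynomial (Fin n) K} (hτ : Function.Surjective τ)
    (E' : Derivation K (MvPolynomial (Fin n) K) (MvPolynomial (Fin n) K)) :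
    ∃ E : Derivation K (MvPolynomial (Fin m) K) (MvPolynomial (Fin m) K),
      ∀ r, τ (E r) = E' (τ r) := by
  choose a ha using fun i => hτ (E' (τ (X i)))
  refine ⟨mkDerivation K a, fun r => ?_⟩
  induction r using MvPolynomial.induction_on with
  | C c => simp [derivation_C]
  | add p q hp hq => simp only [map_add, hp, hq]
  | mul_X p i hp =>
    simp only [Derivation.leibniz, map_add, map_mul, smul_eq_mul, mkDerivation_X, ha, hp]

theorem MvPolynomial.exists_derivation_descent
    {τ : MvPolynomial (Fin m) K →ₐ[K] MvPolynomial (Fin n) K} (hτ : Function.Surjective τ)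
    {h : MvPolynomial (Fin m) K} (hker : ∀ r, τ r = 0 ↔ h ∣ r)
    (E : Derivation K (MvPolynomial (Fin m) K) (MvPolynomial (Fin m) K)) (hE : h ∣ E h) :
    ∃ E' : Derivation K (MvPolynomial (Fin n) K) (MvPolynomial (Fin n) K),
      ∀ r, τ (E r) = E' (τ r) := by
  choose y hy using fun i => hτ (X i)
  refine ⟨mkDerivation K fun i => τ (E (y i)), fun r => ?_⟩
  have h1 : ∀ p, τ (aeval y p) = p := fun p => by
    have : τ.comp (aeval y) = AlgHom.id K _ := by
      ext i : 1
      simp only [AlgHom.comp_apply, aeval_X, hy, AlgHom.id_apply]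
    exact DFunLike.congr_fun this p
  have h2 : ∀ p, τ (E (aeval y p)) = mkDerivation K (fun i => τ (E (y i))) p := fun p => by
    induction p using MvPolynomial.induction_on with
    | C c => rw [aeval_C, Derivation.map_algebraMap, map_zero, derivation_C]
    | add p q hp hq => simp only [map_add, hp, hq]
    | mul_X p i hp =>
      simp only [map_mul, aeval_X, Derivation.leibniz, map_add, smul_eq_mul, mkDerivation_X, hp,
        h1, hy]
  obtain ⟨g, hg⟩ := (hker (r - aeval y (τ r))).1 (by rw [map_sub, h1, sub_self])
  rw [← h2, ← sub_eq_zero, ← map_sub, ← map_sub, hg, Derivation.leibniz, hker]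
  exact dvd_add (Dvd.intro _ rfl) (Dvd.dvd.mul_left hE g)

end Descent

theorem injective_of_lift_away {K : Type} [Field K] {n : ℕ} {f g : MvPolynomial (Fin n) K}
    (hf0 : f ≠ 0) (φ : Localization.Away g →+* Localization.Away f)
    (hφ : ∀ r, φ (algebraMap (MvPolynomial (Fin n) K) _ r) = algebraMap _ _ r) :
    Function.Injective φ := by
  have hα : Function.Injective (algebraMap (MvPolynomial (Fin n) K) (Localization.Away f)) :=
    IsLocalization.injective _ (powers_le_nonZeroDivisors_of_noZeroDivisors hf0)
  rw [injective_iff_map_eq_zero]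
  intro s hs
  obtain ⟨k, r, hr⟩ := IsLocalization.Away.surj g s
  have h1 := congrArg φ hr
  rw [map_mul, hs, zero_mul, hφ, eq_comm, _root_.map_eq_zero_iff _ hα] at h1
  rw [h1, map_zero] at hr
  exact ((IsLocalization.Away.algebraMap_isUnit g).pow k).mul_left_eq_zero.1 hr

section Kashiwara
variable {K : Type} [Field K] [CharZero K] {n n' : ℕ}

set_option maxHeartbeats 1000000 in
/-- Lengths under Kashiwara's equivalence, for the local cohomology of `R[1/f']` along a
hyperplane `h = 0`. -/
theorem length_quotient_range_eq
    {h f f' : MvPolynomial (Fin n) K} (hh : h.totalDegree = 1) (hf : f = h * f') (hf0 : f ≠ 0)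
    {f'' : MvPolynomial (Fin n') K} (hf0'' : f'' ≠ 0)
    {τ : MvPolynomial (Fin n) K →ₐ[K] MvPolynomial (Fin n') K} (hτ : Function.Surjective τ)
    (hker : ∀ r, τ r = 0 ↔ h ∣ r) (hdvd : ∃ k, τ f' ∣ f'' ^ k) (hdvd' : ∃ k, f'' ∣ τ f' ^ k)
    [Module (Weyl K n) (Localization.Away f)] [IsScalarTower K (Weyl K n) (Localization.Away f)]
    (hnatf : NatActs K n f)
    [Module (Weyl K n') (Localization.Away f'')]
    [IsScalarTower K (Weyl K n') (Localization.Away f'')] (hnatf'' : NatActs K n' f'')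
    (φ : Localization.Away f' →+* Localization.Away f)
    (hφ : ∀ r, φ (algebraMap (MvPolynomial (Fin n) K) _ r) = algebraMap _ _ r)
    (S : Submodule (Weyl K n) (Localization.Away f)) (hS : ∀ m, m ∈ S ↔ ∃ s, φ s = m)
    [Module (Weyl K n) (Localization.Away f')] [IsScalarTower K (Weyl K n) (Localization.Away f')]
    (hnatf' : NatActs K n f') :
    Module.length (Weyl K n) (Localization.Away f ⧸ S) =
      Module.length (Weyl K n') (Localization.Away f'') := by
  set α := algebraMap (MvPolynomial (Fin n) K) (Localization.Away f) with hα
  set α' := algebraMap (MvPolynomial (Fin n) K) (Localization.Away f') with hα'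
  set β := algebraMap (MvPolynomial (Fin n') K) (Localization.Away f'') with hβ
  have hαinj : Function.Injective α :=
    IsLocalization.injective _ (powers_le_nonZeroDivisors_of_noZeroDivisors hf0)
  have hβinj : Function.Injective β :=
    IsLocalization.injective _ (powers_le_nonZeroDivisors_of_noZeroDivisors hf0'')
  -- the projection `π` of localizations induced by `τ`
  have hunit : IsUnit ((β.comp (τ : MvPolynomial (Fin n) K →+* MvPolynomial (Fin n') K)) f') :=
    (IsLocalization.Away.algebraMap_isUnit_iff f'').2 hdvd
  let π : Localization.Away f' →+* Localization.Away f'' := IsLocalization.Away.lift f' hunit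
  have hπα : ∀ r, π (α' r) = β (τ r) := fun r => IsLocalization.Away.lift_eq f' hunit r
  obtain ⟨u, hu⟩ : ∃ u, α' f' * u = 1 := ⟨_, IsLocalization.Away.mul_invSelf f'⟩
  have hπu : β (τ f') * π u = 1 := by rw [← hπα, ← map_mul, hu, map_one]
  have hform : ∀ s : Localization.Away f', ∃ (k : ℕ) (r : _), s = α' r * u ^ k := by
    intro s
    obtain ⟨k, r, hr⟩ := IsLocalization.Away.surj f' s
    refine ⟨k, r, ?_⟩
    rw [← hr, mul_assoc, ← mul_pow, hu, one_pow, mul_one]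
  have hπ : Function.Surjective π := by
    intro z
    obtain ⟨k, p, hp⟩ := IsLocalization.Away.surj f'' z
    obtain ⟨N, c, hc⟩ := hdvd'
    obtain ⟨r, hr⟩ := hτ (p * c ^ k)
    refine ⟨α' r * (u ^ N) ^ k, ?_⟩
    have hc' : β f'' * β c = β (τ f') ^ N := by rw [← map_mul, ← hc, map_pow]
    rw [map_mul, hπα, hr, map_mul, ← hp, map_pow, map_pow, map_pow, mul_assoc, mul_assoc,
      ← mul_assoc (_ ^ k), ← mul_pow, ← mul_pow, hc', ← mul_pow, hπu, one_pow, one_pow, mul_one]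
  have hπker : ∀ s, π s = 0 ↔ ∃ g, s = α' h * g := by
    intro s
    refine ⟨fun hs => ?_, ?_⟩
    · obtain ⟨k, r, rfl⟩ := hform s
      have hr : π (α' r) = 0 := by
        have := congrArg (· * π (α' f') ^ k) hs
        simpa only [map_mul, map_pow, mul_assoc, ← mul_pow, hπα, mul_comm (π u), hπu, one_pow,
          mul_one, zero_mul] using this
      rw [hπα, map_eq_zero_iff _ hβinj, hker] at hr
      obtain ⟨g, rfl⟩ := hr
      exact ⟨α' g * u ^ k, by rw [map_mul, mul_assoc]⟩
    · rintro ⟨g, rfl⟩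
      rw [map_mul, hπα, (hker h).2 dvd_rfl, map_zero, zero_mul]
  have hφu : φ (α' f') * φ u = 1 := by rw [← map_mul, hu, map_one]
  have hφinj : Function.Injective φ := injective_of_lift_away hf0 φ hφ
  -- the inverse of `h` and the map `ρ`, induced by `s ↦ s / h`
  have hαf : α f = α h * φ (α' f') :=
    (congrArg α hf).trans (by rw [map_mul, hφ])
  obtain ⟨i₀, hi₀⟩ : ∃ j, α h * j = 1 := by
    refine ⟨φ (α' f') * IsLocalization.Away.invSelf f, ?_⟩
    rw [← mul_assoc, ← hαf]
    exact IsLocalization.Away.mul_invSelf f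
  let ψ : Localization.Away f' →+ Localization.Away f ⧸ S :=
    { toFun := fun s => S.mkQ (φ s * i₀)
      map_zero' := by simp
      map_add' := fun a b => by rw [map_add, add_mul, map_add] }
  have hψ : ∀ s, ψ s = S.mkQ (φ s * i₀) := fun _ => rfl
  have hmk : ∀ z, S.mkQ z = 0 ↔ ∃ s, φ s = z := fun z => by
    rw [← hS, ← LinearMap.mem_ker, Submodule.ker_mkQ]
  have hψker : ∀ s, ψ s = 0 ↔ π s = 0 := by
    intro s
    rw [hψ, hmk, hπker]
    refine exists_congr fun g => ⟨fun hg => hφinj ?_, ?_⟩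
    · rw [map_mul, hφ, hg, mul_comm, mul_assoc, mul_comm i₀, hi₀, mul_one]
    · rintro rfl
      rw [map_mul, hφ, mul_comm, ← mul_assoc, mul_comm i₀, hi₀, one_mul]
  obtain ⟨ρ, hρ⟩ : ∃ ρ : Localization.Away f'' →+ Localization.Away f ⧸ S, ∀ s, ρ (π s) = ψ s :=
    ⟨(π : Localization.Away f' →+ Localization.Away f'').liftOfSurjective hπ
      ⟨ψ, fun s hs => (hψker s).2 hs⟩, fun s =>
      AddMonoidHom.liftOfRightInverse_comp_apply _ _ _ _ s⟩
  have hρinj : Function.Injective ρ := by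
    rw [injective_iff_map_eq_zero]
    intro q hq
    obtain ⟨s, rfl⟩ := hπ q
    rwa [hρ, hψker] at hq
  -- multiplication and derivation operators
  choose w hw using fun r : MvPolynomial (Fin n) K => Weyl.exists_smul_eq_mul r
  choose w'' hw'' using fun r : MvPolynomial (Fin n') K => Weyl.exists_smul_eq_mul r
  choose v hv using fun E : Derivation K (MvPolynomial (Fin n) K) (MvPolynomial (Fin n) K) =>
    Weyl.exists_smul_eq_derivation E
  choose v'' hv'' using fun E : Derivation K (MvPolynomial (Fin n') K) (MvPolynomial (Fin n') K) =>
    Weyl.exists_smul_eq_derivation E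
  have hsm : ∀ (x : Weyl K n) z, x • S.mkQ z = S.mkQ (x • z) := fun x z =>
    (map_smul S.mkQ x z).symm
  have hwα : ∀ r z, w r • z = α r * z := fun r => hw r f hnatf
  have hwβ : ∀ r q, w'' r • q = β r * q := fun r => hw'' r f'' hnatf''
  have hvα : ∀ E : Derivation K (MvPolynomial (Fin n) K) (MvPolynomial (Fin n) K),
      ∃ δ : Derivation K (Localization.Away f) (Localization.Away f),
      (∀ m, v E • m = δ m) ∧ ∀ r, δ (α r) = α (E r) := fun E => hv E f hnatf
  have hvα' : ∀ E : Derivation K (MvPolynomial (Fin n) K) (MvPolynomial (Fin n) K),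
      ∃ δ : Derivation K (Localization.Away f') (Localization.Away f'),
      ∀ r, δ (α' r) = α' (E r) := fun E =>
    let ⟨δ, _, hδ⟩ := hv E f' hnatf'
    ⟨δ, hδ⟩
  have hvβ : ∀ E : Derivation K (MvPolynomial (Fin n') K) (MvPolynomial (Fin n') K),
      ∃ δ : Derivation K (Localization.Away f'') (Localization.Away f''),
      (∀ m, v'' E • m = δ m) ∧ ∀ r, δ (β r) = β (E r) := fun E => hv'' E f'' hnatf''
  have hXα : ∀ i z, wX K n i • z = α (X i) * z := hnatf.1
  have hXβ : ∀ i q, wX K n' i • q = β (X i) * q := hnatf''.1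
  have hDα : ∀ i, ∃ δ : Derivation K (Localization.Away f) (Localization.Away f),
      (∀ m, wD K n i • m = δ m) ∧ ∀ r, δ (α r) = α (pderiv i r) := hnatf.2
  have hDβ : ∀ i, ∃ δ : Derivation K (Localization.Away f'') (Localization.Away f''),
      (∀ m, wD K n' i • m = δ m) ∧ ∀ r, δ (β r) = β (pderiv i r) := hnatf''.2
  have hCα : ∀ (c : K) (z : Localization.Away f), algebraMap K (Weyl K n) c • z =
      α (MvPolynomial.C c) * z := fun c z => Weyl.algebraMap_smul_eq_mul c z
  have hCβ : ∀ (c : K) (z : Localization.Away f''), algebraMap K (Weyl K n') c • z =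
      β (MvPolynomial.C c) * z := fun c z => Weyl.algebraMap_smul_eq_mul c z
  have hsurj : ∀ z : Localization.Away f, ∃ (k : ℕ) (r : _), z * α f ^ k = α r := fun z => by
    obtain ⟨k, r, hr⟩ := IsLocalization.Away.surj f z
    exact ⟨k, r, hr⟩
  have hextα : ∀ {δ δ' : Derivation K (Localization.Away f) (Localization.Away f)},
      (∀ r, δ (α r) = δ' (α r)) → ∀ z, δ z = δ' z := Derivation.ext_away
  have hextβ : ∀ {δ δ' : Derivation K (Localization.Away f'') (Localization.Away f'')},
      (∀ r, δ (β r) = δ' (β r)) → ∀ z, δ z = δ' z := Derivation.ext_away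
  have hcφ : ∀ (δ' : Derivation K (Localization.Away f') (Localization.Away f'))
      (δ : Derivation K (Localization.Away f) (Localization.Away f)),
      (∀ r, φ (δ' (α' r)) = δ (φ (α' r))) → ∀ s, φ (δ' s) = δ (φ s) :=
    Derivation.comm_away_of_comm φ
  have hcπ : ∀ (δ' : Derivation K (Localization.Away f') (Localization.Away f'))
      (δ : Derivation K (Localization.Away f'') (Localization.Away f'')),
      (∀ r, π (δ' (α' r)) = δ (π (α' r))) → ∀ s, π (δ' s) = δ (π s) :=
    Derivation.comm_away_of_comm π
  clear_value α α' β π ψ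
  have hwψ : ∀ r s, w r • ψ s = ψ (α' r * s) := by
    intro r s
    rw [hψ, hψ, hsm, hwα, φ.map_mul, hφ, mul_assoc]
  have hwρ : ∀ r q, w r • ρ q = ρ (w'' (τ r) • q) := by
    intro r q
    obtain ⟨s, rfl⟩ := hπ q
    rw [hρ, hwψ, hwβ, ← hπα, ← map_mul, hρ]
  have hvρ : ∀ E E', (∀ r, τ (E r) = E' (τ r)) → ∀ g, E h = h * g → ∀ q,
      (v E + w g) • ρ q = ρ (v'' E' • q) := by
    intro E E' hEE g hg q
    obtain ⟨s, rfl⟩ := hπ q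
    obtain ⟨δ, hδ, hδα⟩ := hvα E
    obtain ⟨δ', hδα'⟩ := hvα' E
    obtain ⟨δ'', hδ'', hδβ⟩ := hvβ E'
    have h1 : ∀ s, φ (δ' s) = δ (φ s) := hcφ δ' δ fun r => by
      rw [hδα', hφ, hφ, hδα]
    have h2 : ∀ s, π (δ' s) = δ'' (π s) := hcπ δ' δ'' fun r => by
      rw [hδα', hπα, hπα, hEE, hδβ]
    have h3 : δ i₀ = - (α g * i₀) := by
      have h4 := congrArg δ hi₀
      rw [Derivation.leibniz, Derivation.map_one_eq_zero, smul_eq_mul, smul_eq_mul, hδα, hg,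
        map_mul] at h4
      have h5 : i₀ * (α h * δ i₀ + i₀ * (α h * α g)) = δ i₀ * (α h * i₀) +
        α g * i₀ * (α h * i₀) := by ring
      rw [h4, hi₀, mul_zero, mul_one, mul_one] at h5
      exact eq_neg_of_add_eq_zero_left h5.symm
    rw [hρ, add_smul, hwψ, hδ'', ← h2, hρ, hψ, hsm, hδ, Derivation.leibniz, h3, ← h1,
      hψ, hψ, ← map_add, φ.map_mul, hφ]
    congr 1
    simp only [smul_eq_mul]
    ring
  obtain ⟨a, ha, i, hi⟩ := exists_pderiv_eq_C hh
  let E : Derivation K (MvPolynomial (Fin n) K) (MvPolynomial (Fin n) K) := (a i)⁻¹ • pderiv i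
  have hEh : E h = 1 := by
    simp only [E, Derivation.smul_apply, ha, MvPolynomial.smul_eq_C_mul]
    rw [← MvPolynomial.C_mul, inv_mul_cancel₀ hi, MvPolynomial.C_1]
  obtain ⟨δ, hδ, hδα⟩ := hvα E
  have hEX : ∀ j, ∃ c, E (X j) = MvPolynomial.C c := by
    intro j
    classical
    refine ⟨(a i)⁻¹ * (Pi.single i 1 : Fin n → K) j, ?_⟩
    simp only [E, Derivation.smul_apply, pderiv_X, MvPolynomial.smul_eq_C_mul, Pi.single_apply]
    split_ifs <;> simp
  have hmkw : ∀ (r : MvPolynomial (Fin n) K) z, w r • S.mkQ z = S.mkQ (α r * z) := fun r z => by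
    rw [hsm, hwα]
  have hmkv : ∀ z, v E • S.mkQ z = S.mkQ (δ z) := fun z => by rw [hsm, hδ]
  refine length_eq_of_kashiwara ?_ ρ hρinj (w h) (v E) ?_ ?_ ?_ ?_ ?_
  · intro k
    have : ((k + 1 : ℕ) : K) ≠ 0 := Nat.cast_ne_zero.2 (Nat.succ_ne_zero k)
    simpa using (IsUnit.mk0 _ this).map (algebraMap K (Weyl K n))
  · intro m
    obtain ⟨z, rfl⟩ := S.mkQ_surjective m
    rw [hmkw, hmkv, hmkv, hmkw, ← map_add, Derivation.leibniz, hδα, hEh, map_one, smul_eq_mul,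
      smul_eq_mul, mul_one]
  · intro m
    obtain ⟨z, rfl⟩ := S.mkQ_surjective m
    obtain ⟨k, r, hr⟩ := hsurj z
    refine ⟨k, ?_⟩
    have hpow : ∀ k : ℕ, w h ^ k • S.mkQ z = S.mkQ (α h ^ k * z) := by
      intro k
      induction k with
      | zero => simp
      | succ k ih => rw [pow_succ', mul_smul, ih, hmkw, pow_succ', mul_assoc]
    rw [hpow, hmk]
    refine ⟨α' r * u ^ k, ?_⟩
    rw [φ.map_mul, hφ, ← hr, hαf, map_pow, mul_pow, mul_assoc, mul_assoc, ← mul_pow, hφu,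
      one_pow, mul_one, mul_comm]
  · intro m
    constructor
    · obtain ⟨z, rfl⟩ := S.mkQ_surjective m
      rw [hmkw, hmk]
      rintro ⟨s, hs⟩
      exact ⟨π s, by rw [hρ, hψ, hs, mul_right_comm, hi₀, one_mul]⟩
    · rintro ⟨q, rfl⟩
      rw [hwρ, (hker h).2 dvd_rfl, hwβ, map_zero, zero_mul, map_zero]
  · intro x
    induction x using Weyl.induction with
    | hC c =>
      obtain ⟨r, hr⟩ := hτ (MvPolynomial.C c)
      refine ⟨w r, fun q => ?_⟩
      rw [hwρ, hr, hwβ, hCβ]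
    | hX j =>
      obtain ⟨r, hr⟩ := hτ (X j)
      refine ⟨w r, fun q => ?_⟩
      rw [hwρ, hr, hwβ, hXβ]
    | hD j =>
      obtain ⟨E₁, hE₁⟩ := exists_derivation_lift hτ (pderiv j)
      obtain ⟨g, hg⟩ := (hker (E₁ h)).1 (by rw [hE₁, (hker h).2 dvd_rfl, map_zero])
      refine ⟨v E₁ + w g, fun q => ?_⟩
      rw [hvρ E₁ _ hE₁ g hg]
      obtain ⟨δ₁, h1, h2⟩ := hvβ (pderiv j)
      obtain ⟨δ₂, h3, h4⟩ := hDβ j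
      rw [h1, h3, hextβ fun r => (h4 r).trans (h2 r).symm]
    | hadd a b ha hb =>
      obtain ⟨a', ha⟩ := ha
      obtain ⟨b', hb⟩ := hb
      exact ⟨a' + b', fun q => by rw [add_smul, map_add, ha, hb, add_smul]⟩
    | hmul a b ha hb =>
      obtain ⟨a', ha⟩ := ha
      obtain ⟨b', hb⟩ := hb
      exact ⟨a' * b', fun q => by rw [mul_smul, ha, hb, mul_smul]⟩
  · intro T hTd hTt hTg
    have hTw : ∀ r, E r = 0 → ∀ m ∈ T, w r • m ∈ T := by
      intro r hr
      refine hTg (w r) (fun m => ?_) ⟨_, hwρ r⟩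
      obtain ⟨z, rfl⟩ := S.mkQ_surjective m
      rw [hmkv, hmkw, hmkw, hmkv, Derivation.leibniz, hδα, hr, map_zero, smul_zero, add_zero,
        smul_eq_mul]
    have hTC : ∀ (c : K), ∀ m ∈ T, w (MvPolynomial.C c) • m ∈ T := fun c =>
      hTw _ (MvPolynomial.derivation_C E c)
    refine Weyl.smul_mem_of_stable T ?_ ?_ ?_
    · intro c m hm
      have := hTC c m hm
      obtain ⟨z, rfl⟩ := S.mkQ_surjective m
      rwa [hsm, hCα, ← hmkw]
    · intro j m hm
      obtain ⟨c, hc⟩ := hEX j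
      have h1 := hTw (X j - MvPolynomial.C c * h) (by
        rw [map_sub, Derivation.leibniz, hc, hEh, MvPolynomial.derivation_C, smul_zero, add_zero,
          smul_eq_mul, mul_one, sub_self]) m hm
      have h2 := add_mem h1 (hTC c _ (hTt m hm))
      obtain ⟨z, rfl⟩ := S.mkQ_surjective m
      rw [hsm, hXα]
      rw [hmkw, hmkw, hmkw, ← map_add, ← mul_assoc, ← add_mul, ← map_mul, ← map_add,
        sub_add_cancel] at h2
      exact h2
    · intro j m hm
      let θ : Derivation K (MvPolynomial (Fin n) K) (MvPolynomial (Fin n) K) :=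
        pderiv j - a j • E
      have hθh : θ h = 0 := by
        simp only [θ, Derivation.sub_apply, Derivation.smul_apply, hEh, ha,
          MvPolynomial.smul_eq_C_mul, mul_one, sub_self]
      obtain ⟨θ', hθ'⟩ := exists_derivation_descent hτ hker θ (by rw [hθh]; exact dvd_zero h)
      obtain ⟨δ₁, h1, h2⟩ := hvα θ
      obtain ⟨δ₂, h3, h4⟩ := hDα j
      have hcomm : ⁅θ, E⁆ = 0 := by
        refine derivation_ext fun k => ?_
        have hX : ∀ l k : Fin n, ∃ c, pderiv l (X k) = (MvPolynomial.C c : MvPolynomial _ K) := by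
          intro l k
          classical
          refine ⟨(Pi.single l 1 : Fin n → K) k, ?_⟩
          rw [pderiv_X, Pi.single_apply, Pi.single_apply]
          split_ifs <;> simp
        obtain ⟨c, hc⟩ := hX j k
        obtain ⟨c', hc'⟩ := hEX k
        rw [Derivation.commutator_apply, hc', MvPolynomial.derivation_C]
        simp only [θ, Derivation.sub_apply, Derivation.smul_apply, hc, hc', map_sub,
          MvPolynomial.derivation_C, Derivation.map_smul, smul_zero, sub_self,
          Derivation.zero_apply]
      have hcomm' : ∀ z, δ₁ (δ z) = δ (δ₁ z) := by
        intro z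
        have h5 : ⁅δ₁, δ⁆ z = (0 : Derivation K _ _) z := hextα (fun r => by
          rw [Derivation.commutator_apply, hδα, h2, h2, hδα, ← map_sub,
            ← Derivation.commutator_apply, hcomm]
          simp) z
        rwa [Derivation.commutator_apply, Derivation.zero_apply, sub_eq_zero] at h5
      have hsum : ∀ z, δ₂ z = δ₁ z + α (MvPolynomial.C (a j)) * δ z := by
        intro z
        have h5 : δ₂ z = (δ₁ + α (MvPolynomial.C (a j)) • δ) z := hextα (fun r => by
          rw [Derivation.add_apply, Derivation.smul_apply, h4, h2, hδα, smul_eq_mul,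
            ← map_mul, ← map_add]
          simp only [θ, Derivation.sub_apply, Derivation.smul_apply,
            MvPolynomial.smul_eq_C_mul, sub_add_cancel])
          z
        rw [h5, Derivation.add_apply, Derivation.smul_apply, smul_eq_mul]
      have hθT := hTg (v θ) (fun m => by
        obtain ⟨z, rfl⟩ := S.mkQ_surjective m
        rw [hmkv, hsm, hsm, hmkv, h1, h1, hcomm']) ⟨v'' θ', fun q => by
          rw [← hvρ θ θ' hθ' 0 (by rw [hθh, mul_zero]), add_smul, hwρ, map_zero,
            hwβ, map_zero, zero_mul, map_zero, add_zero]⟩ m hm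
      have h6 := add_mem hθT (hTC (a j) _ (hTd m hm))
      obtain ⟨z, rfl⟩ := S.mkQ_surjective m
      rw [hmkv, hmkw, hsm, h1, ← map_add, ← hsum] at h6
      rwa [hsm, h3]

end Kashiwara

section Assembly
variable {K : Type} [Field K] {n : ℕ}

/-- A ring homomorphism between localizations over `K[x₁,…,xₙ]` is linear over the Weyl algebra. -/
theorem NatActs.map_smul {f g : MvPolynomial (Fin n) K}
    [Module (Weyl K n) (Localization.Away f)] [IsScalarTower K (Weyl K n) (Localization.Away f)]
    [Module (Weyl K n) (Localization.Away g)] [IsScalarTower K (Weyl K n) (Localization.Away g)]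
    (hf : NatActs K n f) (hg : NatActs K n g)
    (φ : Localization.Away g →+* Localization.Away f)
    (hφ : ∀ r, φ (algebraMap (MvPolynomial (Fin n) K) _ r) = algebraMap _ _ r)
    (w : Weyl K n) : ∀ m, φ (w • m) = w • φ m := by
  induction w using Weyl.induction with
  | hC c =>
    intro m
    rw [Weyl.algebraMap_smul_eq_mul, Weyl.algebraMap_smul_eq_mul, map_mul, hφ]
  | hX i =>
    intro m
    rw [hf.1, hg.1, map_mul, hφ]
  | hD i =>
    intro m
    obtain ⟨δ, hδ, hδ'⟩ := hf.2 i
    obtain ⟨ε, hε, hε'⟩ := hg.2 i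
    rw [hδ, hε]
    exact Derivation.comm_away_of_comm φ ε δ (fun r => by rw [hε', hφ, hφ, hδ']) m
  | hadd a b ha hb => exact fun m => by rw [add_smul, add_smul, map_add, ha, hb]
  | hmul a b ha hb => exact fun m => by rw [mul_smul, mul_smul, ha, hb]

/-- Local cohomology of a product: the exact sequence coming from `R ⊆ R[1/g] ⊆ R[1/f]`. -/
theorem length_H1_eq_add {f g : MvPolynomial (Fin n) K}
    [Module (Weyl K n) (Localization.Away f)] [Module (Weyl K n) (Localization.Away g)]
    [IsScalarTower K (Weyl K n) (Localization.Away f)]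
    [IsScalarTower K (Weyl K n) (Localization.Away g)]
    (hf : NatActs K n f) (hg : NatActs K n g)
    (φ : Localization.Away g →ₗ[Weyl K n] Localization.Away f)
    (hφ : ∀ r, φ (algebraMap (MvPolynomial (Fin n) K) _ r) = algebraMap _ _ r)
    (hinj : Function.Injective φ) :
    Module.length (Weyl K n) (H1 K n f) = Module.length (Weyl K n) (H1 K n g) +
      Module.length (Weyl K n) (Localization.Away f ⧸ LinearMap.range φ) := by
  set N := Submodule.span (Weyl K n)
    (Set.range (algebraMap (MvPolynomial (Fin n) K) (Localization.Away f)))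
  set N' := Submodule.span (Weyl K n)
    (Set.range (algebraMap (MvPolynomial (Fin n) K) (Localization.Away g)))
  have hN : ∀ m, m ∈ N ↔ ∃ r, algebraMap _ _ r = m := mem_span_range_algebraMap_iff hf
  have hN' : ∀ m, m ∈ N' ↔ ∃ r, algebraMap _ _ r = m := mem_span_range_algebraMap_iff hg
  have hcomap : N' = N.comap φ := by
    ext m
    rw [Submodule.mem_comap, hN, hN']
    refine exists_congr fun r => ⟨fun h => by rw [← h, hφ], fun h => hinj (by rw [hφ, h])⟩
  have hle : N ≤ LinearMap.range φ := fun m hm => by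
    obtain ⟨r, rfl⟩ := (hN m).1 hm
    exact ⟨_, hφ r⟩
  refine Module.length_eq_add_of_exact (N'.mapQ N φ hcomap.le) (Submodule.factor hle) ?_ ?_ ?_
  · rw [← LinearMap.ker_eq_bot, Submodule.ker_mapQ, ← hcomap, Submodule.mkQ_map_self]
  · exact Submodule.factor_surjective hle
  · rw [LinearMap.exact_iff, Submodule.range_mapQ, Submodule.factor, Submodule.ker_mapQ,
      Submodule.comap_id]

end Assembly

section Restriction
variable {K : Type} [Field K] {m n : ℕ}

theorem MvPolynomial.exists_eval_eq_of_surjective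
    {τ : MvPolynomial (Fin m) K →ₐ[K] MvPolynomial (Fin n) K} (hτ : Function.Surjective τ)
    {h : MvPolynomial (Fin m) K} (hker : ∀ r, τ r = 0 ↔ h ∣ r) {x : Fin m → K}
    (hx : eval x h = 0) : ∃ y : Fin n → K, ∀ r, eval x r = eval y (τ r) := by
  choose Y hY using fun i => hτ (X i)
  refine ⟨fun i => eval x (Y i), fun r => ?_⟩
  have h1 : ∀ p, τ (aeval Y p) = p := fun p => by
    have : τ.comp (aeval Y) = AlgHom.id K _ := by
      ext i : 1
      simp only [AlgHom.comp_apply, aeval_X, hY, AlgHom.id_apply]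
    exact DFunLike.congr_fun this p
  have h2 : ∀ p, eval x (aeval Y p) = eval (fun i => eval x (Y i)) p := fun p => by
    induction p using MvPolynomial.induction_on with
    | C c => simp [MvPolynomial.algebraMap_eq]
    | add p q hp hq => simp only [map_add, hp, hq]
    | mul_X p i hp => simp only [map_mul, hp, aeval_X, eval_X]
  obtain ⟨g, hg⟩ := (hker (r - aeval Y (τ r))).1 (by rw [map_sub, h1, sub_self])
  have := congrArg (eval x) hg
  rwa [map_sub, map_mul, hx, zero_mul, h2, sub_eq_zero] at this

/-- If `p` vanishes wherever the restriction `τ q` of a linear polynomial `q` vanishes, then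
`τ q` divides `p`. -/
theorem MvPolynomial.map_dvd_of_forall_eval_eq_zero [CharZero K]
    {τ : MvPolynomial (Fin m) K →ₐ[K] MvPolynomial (Fin n) K} (hτ : Function.Surjective τ)
    {h : MvPolynomial (Fin m) K} (hker : ∀ r, τ r = 0 ↔ h ∣ r) (hh : h.totalDegree = 1)
    {q : MvPolynomial (Fin m) K} (hq : q.totalDegree = 1) {p : MvPolynomial (Fin n) K}
    (hp : ∀ y, eval y (τ q) = 0 → eval y p = 0) : τ q ∣ p := by
  obtain ⟨r, rfl⟩ := hτ p
  obtain ⟨g, hg⟩ := exists_dvd_sub_mul_of_forall_eval_eq_zero hh hq (p := r) (fun x hx hxq => by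
    obtain ⟨y, hy⟩ := exists_eval_eq_of_surjective hτ hker hx
    rw [hy] at hxq ⊢
    exact hp y hxq)
  rw [← hker, map_sub, map_mul, sub_eq_zero] at hg
  exact Dvd.intro _ hg.symm

end Restriction

open scoped Classical in
/-- Deletion-restriction for length: for a hyperplane
arrangement defined by `f` in `R = K[x₁,…,x_{n'+1}]`, with `H₀ ∈ 𝒜` defined by
`h₀ ∈ A`, deleted arrangement defined by `f'`, and restricted arrangement in
`H₀ ≅ K^{n'}` defined by `f'' ∈ R'' ≅ K[x₁,…,x_{n'}]` (the identification
being given by the isomorphism `e : R/(h₀) ≅ R''`, with induced point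
correspondence `pt`), one has
`length H¹_{(f)}(R) = length H¹_{(f')}(R) + length H¹_{(f'')}(R'') + 1`. -/
theorem length_deletion_restriction
    (K : Type) [Field K] [CharZero K] (n' : ℕ)
    (A : Finset (MvPolynomial (Fin (n' + 1)) K))
    (hdegA : ∀ p ∈ A, p.totalDegree = 1)
    (hdist : ∀ p ∈ A, ∀ q ∈ A, p ≠ q →
      zeroSet K (n' + 1) p ≠ zeroSet K (n' + 1) q)
    (h₀ : MvPolynomial (Fin (n' + 1)) K) (hh₀ : h₀ ∈ A)
    (f f' : MvPolynomial (Fin (n' + 1)) K)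
    (hf : f = ∏ p ∈ A, p) (hf' : f' = ∏ p ∈ A.erase h₀, p)
    (e : (MvPolynomial (Fin (n' + 1)) K ⧸ Ideal.span {h₀}) ≃ₐ[K]
      MvPolynomial (Fin n') K)
    (pt : (Fin n' → K) → (Fin (n' + 1) → K))
    (hpt : ∀ (y : Fin n' → K) (q : MvPolynomial (Fin (n' + 1)) K),
      MvPolynomial.eval (pt y) q =
        MvPolynomial.eval y (e (Ideal.Quotient.mk (Ideal.span {h₀}) q)))
    (B : Finset (MvPolynomial (Fin n') K))
    (hdegB : ∀ b ∈ B, b.totalDegree = 1)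
    (hBdist : ∀ b ∈ B, ∀ c ∈ B, b ≠ c → zeroSet K n' b ≠ zeroSet K n' c)
    (hB : B.image (zeroSet K n') =
      ((A.erase h₀).image fun q =>
        {y : Fin n' → K | MvPolynomial.eval (pt y) q = 0}).filter
          fun X => X ≠ ∅)
    (f'' : MvPolynomial (Fin n') K) (hf'' : f'' = ∏ b ∈ B, b)
    [Module (Weyl K (n' + 1)) (Localization.Away f)]
    [IsScalarTower K (Weyl K (n' + 1)) (Localization.Away f)]
    (hnatf : NatActs K (n' + 1) f)
    [Module (Weyl K (n' + 1)) (Localization.Away f')]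
    [IsScalarTower K (Weyl K (n' + 1)) (Localization.Away f')]
    (hnatf' : NatActs K (n' + 1) f')
    [Module (Weyl K n') (Localization.Away f'')]
    [IsScalarTower K (Weyl K n') (Localization.Away f'')]
    (hnatf'' : NatActs K n' f'') :
    mlength (Weyl K (n' + 1)) (H1 K (n' + 1) f) =
      mlength (Weyl K (n' + 1)) (H1 K (n' + 1) f') +
      mlength (Weyl K n') (H1 K n' f'') + 1 := by
  have hne : ∀ {k : ℕ} {p : MvPolynomial (Fin k) K}, p.totalDegree = 1 → p ≠ 0 := by
    rintro k p hp rfl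
    simp at hp
  let τ : MvPolynomial (Fin (n' + 1)) K →ₐ[K] MvPolynomial (Fin n') K :=
    e.toAlgHom.comp (Ideal.Quotient.mkₐ K (Ideal.span {h₀}))
  have hτe : ∀ r, τ r = e (Ideal.Quotient.mk (Ideal.span {h₀}) r) := fun _ => rfl
  have hτ : Function.Surjective τ := e.surjective.comp Ideal.Quotient.mk_surjective
  have hker : ∀ r, τ r = 0 ↔ h₀ ∣ r := fun r => by
    rw [hτe, EmbeddingLike.map_eq_zero_iff, Ideal.Quotient.eq_zero_iff_mem,
      Ideal.mem_span_singleton]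
  have hset : ∀ q, {y : Fin n' → K | MvPolynomial.eval (pt y) q = 0} = zeroSet K n' (τ q) :=
    fun q => by simp only [hpt, zeroSet, hτe]
  have hff : f = h₀ * f' := by rw [hf, hf', Finset.mul_prod_erase A (fun p => p) hh₀]
  have hf0 : f ≠ 0 := hf ▸ Finset.prod_ne_zero_iff.2 fun p hp => hne (hdegA p hp)
  have hf0'' : f'' ≠ 0 := hf'' ▸ Finset.prod_ne_zero_iff.2 fun b hb => hne (hdegB b hb)
  have hτf' : τ f' = ∏ q ∈ A.erase h₀, τ q := by rw [hf', map_prod]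
  have hdvd : τ f' ∣ f'' ^ (A.erase h₀).card := by
    rw [hτf', ← Finset.prod_const]
    refine Finset.prod_dvd_prod_of_dvd _ _ fun q hq => ?_
    refine map_dvd_of_forall_eval_eq_zero hτ hker (hdegA _ hh₀)
      (hdegA q (Finset.mem_of_mem_erase hq)) fun y hy => ?_
    have hmem : zeroSet K n' (τ q) ∈ B.image (zeroSet K n') := by
      rw [hB, Finset.mem_filter, ← hset]
      refine ⟨Finset.mem_image_of_mem _ hq, ?_⟩
      rw [hset]
      exact Set.nonempty_iff_ne_empty.1 ⟨y, hy⟩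
    obtain ⟨b, hb, hbq⟩ := Finset.mem_image.1 hmem
    have hyb : y ∈ zeroSet K n' b := hbq ▸ hy
    rw [hf'', map_prod]
    exact Finset.prod_eq_zero hb hyb
  have hdvd' : f'' ∣ τ f' ^ B.card := by
    rw [hf'', ← Finset.prod_const]
    refine Finset.prod_dvd_prod_of_dvd _ _ fun b hb => ?_
    have hmem := Finset.mem_image_of_mem (zeroSet K n') hb
    rw [hB] at hmem
    obtain ⟨q, hq, hqb⟩ := Finset.mem_image.1 (Finset.mem_filter.1 hmem).1
    rw [hset] at hqb
    refine (dvd_of_forall_eval_eq_zero (hdegB b hb) fun y hy => ?_).trans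
      (hτf' ▸ Finset.dvd_prod_of_mem _ hq)
    have hyb : y ∈ zeroSet K n' b := hy
    exact (hqb ▸ hyb : y ∈ zeroSet K n' (τ q))
  have hunit : IsUnit (algebraMap (MvPolynomial (Fin (n' + 1)) K) (Localization.Away f) f') :=
    IsLocalization.Away.isUnit_of_dvd f (Dvd.intro_left _ hff.symm)
  let φ : Localization.Away f' →+* Localization.Away f := IsLocalization.Away.lift f' hunit
  have hφ : ∀ r, φ (algebraMap (MvPolynomial (Fin (n' + 1)) K) _ r) = algebraMap _ _ r :=
    fun r => IsLocalization.Away.lift_eq f' hunit r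
  let φD : Localization.Away f' →ₗ[Weyl K (n' + 1)] Localization.Away f :=
    { toFun := φ
      map_add' := map_add φ
      map_smul' := NatActs.map_smul hnatf hnatf' φ hφ }
  have hinj : Function.Injective φ := injective_of_lift_away hf0 φ hφ
  have h1 := length_H1_eq_add hnatf hnatf' φD hφ hinj
  rw [length_quotient_range_eq (hdegA _ hh₀) hff hf0 hf0'' hτ hker ⟨_, hdvd⟩ ⟨_, hdvd'⟩ hnatf
    hnatf'' φ hφ (LinearMap.range φD) (fun _ => LinearMap.mem_range) hnatf',
    length_localization_eq_add_one hnatf'' hf0''] at h1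
  simp only [mlength, ← Module.coe_length]
  rw [h1, ← add_assoc]
  rfl
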